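/- Fix n ≥ 1. If a morphism f : G → H of n-globular sets is surjective on 0-cells and full (k-full for all 1 ≤ k ≤ n), then f is a split epimorphism: there exists a morphism f' : H → G of n-globular sets such that f_k ∘ f'_k = id_{H_k} for all 0 ≤ k ≤ n. -/

import Mathlib

/-- An `n`-globular set: sets of `k`-cells for `0 ≤ k ≤ n`, with source and target
maps satisfying the globular identities.  (Cells in dimensions above `n` play no
role in any definition below.) -/
structure NGlob (n : ℕ) : Type 1 where
  cell : ℕ → Type
  src : ∀ k, k < n → cell (k + 1) → cell k
  tgt : ∀ k, k < n → cell (k + 1) → cell k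
  src_src : ∀ k (h : k + 1 < n) (x : cell (k + 2)),
    src k (Nat.lt_of_succ_lt h) (src (k + 1) h x) =
      src k (Nat.lt_of_succ_lt h) (tgt (k + 1) h x)
  tgt_tgt : ∀ k (h : k + 1 < n) (x : cell (k + 2)),
    tgt k (Nat.lt_of_succ_lt h) (src (k + 1) h x) =
      tgt k (Nat.lt_of_succ_lt h) (tgt (k + 1) h x)

/-- A morphism of `n`-globular sets: a family of maps in dimensions `0,…,n`
commuting with sources and targets. -/
structure NGlobMap {n : ℕ} (G H : NGlob n) where
  app : ∀ k, k ≤ n → G.cell k → H.cell k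
  comm_src : ∀ k (h : k < n) (x : G.cell (k + 1)),
    app k (Nat.le_of_lt h) (G.src k h x) = H.src k h (app (k + 1) h x)
  comm_tgt : ∀ k (h : k < n) (x : G.cell (k + 1)),
    app k (Nat.le_of_lt h) (G.tgt k h x) = H.tgt k h (app (k + 1) h x)

/-- Two `k`-cells are parallel if they have the same source and target;
all pairs of `0`-cells are parallel. -/
def NGlob.Parallel {n : ℕ} (G : NGlob n) : ∀ k, k ≤ n → G.cell k → G.cell k → Prop
  | 0, _, _, _ => True
  | k + 1, h, x, x' => G.src k h x = G.src k h x' ∧ G.tgt k h x = G.tgt k h x'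

/-- `f` is `(k+1)`-full: for every parallel pair `(x, x')` of `k`-cells of `G`,
every `(k+1)`-cell of `H` from `f x` to `f x'` is the image of a `(k+1)`-cell of
`G` from `x` to `x'`. -/
def NGlobMap.KFull {n : ℕ} {G H : NGlob n} (f : NGlobMap G H) (k : ℕ) (h : k < n) : Prop :=
  ∀ x x' : G.cell k, G.Parallel k (Nat.le_of_lt h) x x' →
    ∀ ψ : H.cell (k + 1), H.src k h ψ = f.app k (Nat.le_of_lt h) x →
      H.tgt k h ψ = f.app k (Nat.le_of_lt h) x' →
        ∃ χ : G.cell (k + 1), G.src k h χ = x ∧ G.tgt k h χ = x' ∧ f.app (k + 1) h χ = ψ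

/-- `f` is full: `k`-full for every `1 ≤ k ≤ n`. -/
def NGlobMap.Full {n : ℕ} {G H : NGlob n} (f : NGlobMap G H) : Prop :=
  ∀ k (h : k < n), f.KFull k h

/-- `f` is `(k+1)`-faithful: for every parallel pair of `(k+1)`-cells of `G`
(having the same source and the same target), equal images under `f` imply
the cells are equal. -/
def NGlobMap.KFaithful {n : ℕ} {G H : NGlob n} (f : NGlobMap G H) (k : ℕ) (h : k < n) : Prop :=
  ∀ χ χ' : G.cell (k + 1), G.src k h χ = G.src k h χ' → G.tgt k h χ = G.tgt k h χ' →
    f.app (k + 1) h χ = f.app (k + 1) h χ' → χ = χ'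

/-- The source and target of a cell are parallel. -/
lemma NGlob.parallel_src_tgt {n : ℕ} (G : NGlob n) :
    ∀ k (h : k < n) (x : G.cell (k + 1)),
      G.Parallel k (Nat.le_of_lt h) (G.src k h x) (G.tgt k h x)
  | 0, _, _ => trivial
  | k + 1, h, x => ⟨G.src_src k h x, G.tgt_tgt k h x⟩

/-- The sections of `f` on `k`-cells that preserve parallel pairs. -/
def NGlobMap.ParallelSection {n : ℕ} {G H : NGlob n} (f : NGlobMap G H) (k : ℕ) (hk : k ≤ n) :
    Type :=
  {g : H.cell k → G.cell k // (∀ y, f.app k hk (g y) = y) ∧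
    ∀ y y', H.Parallel k hk y y' → G.Parallel k hk (g y) (g y')}

/-- Along a full map, a parallelism-preserving section on `k`-cells extends to `(k+1)`-cells. -/
lemma NGlobMap.Full.exists_parallelSection_succ {n : ℕ} {G H : NGlob n} {f : NGlobMap G H}
    (hf : f.Full) (k : ℕ) (h : k < n) (g : f.ParallelSection k (Nat.le_of_lt h)) :
    ∃ g' : f.ParallelSection (k + 1) h, ∀ y,
      G.src k h (g'.1 y) = g.1 (H.src k h y) ∧ G.tgt k h (g'.1 y) = g.1 (H.tgt k h y) := by
  have lift (y : H.cell (k + 1)) := hf k h (g.1 (H.src k h y)) (g.1 (H.tgt k h y))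
    (g.2.2 _ _ (H.parallel_src_tgt k h y)) y (g.2.1 _).symm (g.2.1 _).symm
  choose g' hsrc htgt happ using lift
  refine ⟨⟨g', happ, fun y y' hy => ?_⟩, fun y => ⟨hsrc y, htgt y⟩⟩
  exact ⟨by rw [hsrc, hsrc, hy.1], by rw [htgt, htgt, hy.2]⟩

/-- Compatible sections of a full map in all dimensions, extending a given section on
`0`-cells. -/
noncomputable def NGlobMap.Full.parallelSection {n : ℕ} {G H : NGlob n} {f : NGlobMap G H}
    (hf : f.Full) (g : f.ParallelSection 0 (Nat.zero_le n)) :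
    ∀ k (hk : k ≤ n), f.ParallelSection k hk
  | 0, _ => g
  | k + 1, hk => (hf.exists_parallelSection_succ k hk
      (hf.parallelSection g k (Nat.le_of_lt hk))).choose

lemma NGlobMap.Full.parallelSection_comm {n : ℕ} {G H : NGlob n} {f : NGlobMap G H}
    (hf : f.Full) (g : f.ParallelSection 0 (Nat.zero_le n)) (k : ℕ) (h : k < n)
    (y : H.cell (k + 1)) :
    G.src k h ((hf.parallelSection g (k + 1) h).1 y) =
        (hf.parallelSection g k (Nat.le_of_lt h)).1 (H.src k h y) ∧
      G.tgt k h ((hf.parallelSection g (k + 1) h).1 y) =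
        (hf.parallelSection g k (Nat.le_of_lt h)).1 (H.tgt k h y) :=
  (hf.exists_parallelSection_succ k h (hf.parallelSection g k (Nat.le_of_lt h))).choose_spec y

/-- For `n ≥ 1` (here the paper's `n` is `n + 1`): if a morphism of
`(n+1)`-globular sets is surjective on `0`-cells and full, then it is a split
epimorphism. -/
theorem stmt8 (n : ℕ) {G H : NGlob (n + 1)} (f : NGlobMap G H)
    (h0 : Function.Surjective (f.app 0 (Nat.zero_le (n + 1))))
    (hfull : f.Full) :
    ∃ f' : NGlobMap H G, ∀ k (hk : k ≤ n + 1) (y : H.cell k),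
      f.app k hk (f'.app k hk y) = y := by
  obtain ⟨g₀, hg₀⟩ := h0.hasRightInverse
  let g : f.ParallelSection 0 (Nat.zero_le (n + 1)) := ⟨g₀, hg₀, fun _ _ _ => trivial⟩
  exact ⟨⟨fun k hk => (hfull.parallelSection g k hk).1,
    fun k h y => (hfull.parallelSection_comm g k h y).1.symm,
    fun k h y => (hfull.parallelSection_comm g k h y).2.symm⟩,
    fun k hk => (hfull.parallelSection g k hk).2.1⟩
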